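/- arXiv:math/0404396 — 8 statements merged into one kernel-verified Lean document; each statement's English description precedes it below -/
import Mathlib

section
/- Let A be an m-by-n array of real numbers. Let A′ be the array obtained from A by row-sorting, and let A″ be the array obtained from A′ by column-sorting. Then every row of A″ is weakly increasing. -/
/-- `B` is obtained from the `m`-by-`n` array `A` by row-sorting: for each row index `i`,
the sequence `(B i 1, …, B i n)` is a weakly increasing rearrangement of
`(A i 1, …, A i n)`. -/
def IsRowSort (m n : ℕ) (A B : Fin m → Fin n → ℝ) : Prop :=
  ∀ i : Fin m, ∃ σ : Equiv.Perm (Fin n), (∀ j, B i j = A i (σ j)) ∧ Monotone (B i)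

/-- `B` is obtained from the `m`-by-`n` array `A` by column-sorting: for each column index `j`,
the sequence `(B 1 j, …, B m j)` is a weakly increasing rearrangement of
`(A 1 j, …, A m j)`. -/
def IsColSort (m n : ℕ) (A B : Fin m → Fin n → ℝ) : Prop :=
  ∀ j : Fin n, ∃ σ : Equiv.Perm (Fin m), (∀ i, B i j = A (σ i) j) ∧ Monotone (fun i => B i j)

/-- A permutation of `Fin m` cannot map the first `i + 1` indices into the first `i`. -/
theorem Fin.exists_le_and_le_perm {m : ℕ} (π : Equiv.Perm (Fin m)) (i : Fin m) :
    ∃ k ≤ i, i ≤ π k := by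
  by_contra! h
  have hcard : (Finset.Iic i).card ≤ (Finset.Iio i).card :=
    Finset.card_le_card_of_injOn π
      (fun k hk => Finset.mem_coe.2 (Finset.mem_Iio.2 (h k (Finset.mem_Iic.1 hk))))
      π.injective.injOn
  rw [Fin.card_Iic, Fin.card_Iio] at hcard
  omega

/-- Sorting preserves the pointwise order: if `f ≤ g`, then the weakly increasing rearrangements
of `f` and `g` are related in the same way. -/
theorem comp_perm_le_comp_perm_of_monotone {m : ℕ} {α : Type*} [Preorder α] {f g : Fin m → α}
    (hfg : f ≤ g) {σ τ : Equiv.Perm (Fin m)} (hf : Monotone (f ∘ σ)) (hg : Monotone (g ∘ τ)) :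
    f ∘ σ ≤ g ∘ τ := by
  intro i
  obtain ⟨k, hki, hik⟩ := Fin.exists_le_and_le_perm (τ.trans σ.symm) i
  calc
    f (σ i) ≤ f (σ ((τ.trans σ.symm) k)) := hf hik
    _ = f (τ k) := by simp
    _ ≤ g (τ k) := hfg _
    _ ≤ g (τ i) := hg hki

/-- The Non-Messing-Up Theorem: row-sort an `m`-by-`n` real array, then column-sort the
result; every row of the resulting array is weakly increasing. -/
theorem nonMessingUp_rows (m n : ℕ) (A A' A'' : Fin m → Fin n → ℝ)
    (h1 : IsRowSort m n A A') (h2 : IsColSort m n A' A'') :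
    ∀ i : Fin m, Monotone (A'' i) := by
  intro i j k hjk
  obtain ⟨σ, hσ, hσ_mono⟩ := h2 j
  obtain ⟨τ, hτ, hτ_mono⟩ := h2 k
  have hle : (fun r => A' r j) ≤ fun r => A' r k := fun r => by
    obtain ⟨_, _, hmono⟩ := h1 r
    exact hmono hjk
  simp only [hσ] at hσ_mono
  simp only [hτ] at hτ_mono
  rw [hσ, hτ]
  exact comp_perm_le_comp_perm_of_monotone hle hσ_mono hτ_mono i
end

section
/- Let A be an m-by-n array of real numbers. Let A′ be the array obtained from A by column-sorting, and let A″ be the array obtained from A′ by row-sorting. Then every column of A″ is weakly increasing. -/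
/-- If `f` and `g` are weakly increasing and `f` is dominated by a rearrangement of `g`, then
`f` is dominated by `g`. -/
theorem le_of_monotone_of_le_comp_perm {α : Type*} [Preorder α] {n : ℕ} {f g : Fin n → α}
    (hf : Monotone f) (hg : Monotone g) (π : Equiv.Perm (Fin n)) (h : ∀ k, f k ≤ g (π k)) :
    f ≤ g := by
  intro j
  obtain ⟨k, hjk, hkj⟩ : ∃ k, j ≤ k ∧ π k ≤ j := by
    by_contra! hc
    have hcard : (Finset.Ici j).card ≤ (Finset.Ioi j).card :=
      Finset.card_le_card_of_injOn π (fun k hk => by simpa using hc k (by simpa using hk))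
        π.injective.injOn
    simp only [Fin.card_Ici, Fin.card_Ioi] at hcard
    omega
  exact (hf hjk).trans ((h k).trans (hg hkj))

/-- The Non-Messing-Up Theorem (transposed form): column-sort an `m`-by-`n` real array,
then row-sort the result; every column of the resulting array is weakly increasing. -/
theorem nonMessingUp_cols (m n : ℕ) (A A' A'' : Fin m → Fin n → ℝ)
    (h1 : IsColSort m n A A') (h2 : IsRowSort m n A' A'') :
    ∀ j : Fin n, Monotone (fun i => A'' i j) := by
  intro j i i' hii'
  obtain ⟨σ, hσ, hmono⟩ := h2 i
  obtain ⟨τ, hτ, hmono'⟩ := h2 i'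
  refine le_of_monotone_of_le_comp_perm hmono hmono' (σ.trans τ.symm) (fun k => ?_) j
  obtain ⟨_, -, hcol⟩ := h1 (σ k)
  simpa [hσ, hτ] using hcol hii'
end

section
/- A finite poset belongs to N₂ if and only if each of its connected components belongs to N₂. -/
/-- A saturated chain in a poset: a chain such that any two consecutive elements of the
chain form a covering relation of the ambient poset. -/
def IsSatChain (P : Type*) [PartialOrder P] (c : Set P) : Prop :=
  IsChain (· ≤ ·) c ∧
    ∀ x ∈ c, ∀ y ∈ c, x < y → (∀ z ∈ c, ¬(x < z ∧ z < y)) → x ⋖ y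

/-- A chain cover of a poset: a set of pairwise disjoint saturated chains whose
union is the whole poset. -/
def IsChainCover (P : Type*) [PartialOrder P] (C : Set (Set P)) : Prop :=
  (∀ c ∈ C, IsSatChain P c) ∧ C.PairwiseDisjoint id ∧ ∀ x : P, ∃ c ∈ C, x ∈ c

/-- `mu` is the `C`-sort of the labeling `lam`: on each chain of `C`, `mu` rearranges the
multiset of `lam`-labels of that chain so that they are weakly increasing along the chain. -/
def IsCSort (P : Type*) [PartialOrder P] (C : Set (Set P)) (lam mu : P → ℝ) : Prop :=
  ∃ σ : Equiv.Perm P, (∀ c ∈ C, ∀ x ∈ c, σ x ∈ c) ∧ (∀ x, mu x = lam (σ x)) ∧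
    ∀ c ∈ C, ∀ x ∈ c, ∀ y ∈ c, x ≤ y → mu x ≤ mu y

/-- The labeling `nu` is weakly increasing along every chain of `C`. -/
def SortedAlong (P : Type*) [PartialOrder P] (C : Set (Set P)) (nu : P → ℝ) : Prop :=
  ∀ c ∈ C, ∀ x ∈ c, ∀ y ∈ c, x ≤ y → nu x ≤ nu y

/-- `P` has the non-messing-up property via the (unordered) pair of chain covers
`{C₁, C₂}`: for any labeling, sorting along one cover and then along the other leaves the
labels sorted along the chains of the first cover, and moreover every covering relation of
`P` lies in some chain of `C₁` or of `C₂`. -/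
def NMUvia (P : Type*) [PartialOrder P] (C₁ C₂ : Set (Set P)) : Prop :=
  IsChainCover P C₁ ∧ IsChainCover P C₂ ∧
  (∀ lam mu nu : P → ℝ, IsCSort P C₁ lam mu → IsCSort P C₂ mu nu → SortedAlong P C₁ nu) ∧
  (∀ lam mu nu : P → ℝ, IsCSort P C₂ lam mu → IsCSort P C₁ mu nu → SortedAlong P C₂ nu) ∧
  ∀ x y : P, x ⋖ y → ∃ c, (c ∈ C₁ ∨ c ∈ C₂) ∧ x ∈ c ∧ y ∈ c

/-- The class `N₂`: posets having the non-messing-up property via some pair of chain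
covers. -/
def InN2 (P : Type*) [PartialOrder P] : Prop := ∃ C₁ C₂, NMUvia P C₁ C₂

/-- The connected component of `x` in the comparability graph of the poset `P`. -/
def ConnComp (P : Type*) [PartialOrder P] (x : P) : Set P :=
  {y | Relation.ReflTransGen (fun a b : P => a ≤ b ∨ b ≤ a) x y}


/-- A set is comparability-closed if it contains every element comparable to one of its
elements. -/
def IsCompClosed {P : Type*} [PartialOrder P] (S : Set P) : Prop :=
  ∀ a ∈ S, ∀ b, a ≤ b ∨ b ≤ a → b ∈ S

theorem mem_connComp_self {P : Type*} [PartialOrder P] (x : P) : x ∈ ConnComp P x :=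
  Relation.ReflTransGen.refl

theorem isCompClosed_connComp {P : Type*} [PartialOrder P] (x : P) :
    IsCompClosed (ConnComp P x) :=
  fun _ ha _ hab => Relation.ReflTransGen.tail ha hab

theorem connComp_eq_of_mem {P : Type*} [PartialOrder P] {x y : P} (h : y ∈ ConnComp P x) :
    ConnComp P x = ConnComp P y := by
  have hsymm : Relation.ReflTransGen (fun a b : P => a ≤ b ∨ b ≤ a) y x := by
    have : Std.Symm (fun a b : P => a ≤ b ∨ b ≤ a) := ⟨fun _ _ hab => hab.symm⟩
    exact Relation.ReflTransGen.stdSymm.symm _ _ h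
  ext z
  exact ⟨fun hz => hsymm.trans hz, fun hz => Relation.ReflTransGen.trans h hz⟩

theorem IsCompClosed.mem_of_isChain {P : Type*} [PartialOrder P] {S : Set P}
    (hS : IsCompClosed S) {c : Set P} (hc : IsChain (· ≤ ·) c) {x y : P} (hx : x ∈ c)
    (hy : y ∈ c) (hxS : x ∈ S) : y ∈ S :=
  hS x hxS y (hc.total hx hy)

theorem IsCompClosed.covBy_iff {P : Type*} [PartialOrder P] {S : Set P}
    (hS : IsCompClosed S) {x y : S} : (x : P) ⋖ y ↔ x ⋖ y := by
  refine ⟨fun h => ⟨h.1, fun z hxz hzy => h.2 (c := (z : P)) hxz hzy⟩, fun h => ⟨h.1, ?_⟩⟩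
  intro z hxz hzy
  exact h.2 (c := ⟨z, hS x x.2 z (Or.inl hxz.le)⟩) hxz hzy

theorem IsCompClosed.isSatChain_preimage {P : Type*} [PartialOrder P] {S : Set P}
    (hS : IsCompClosed S) {c : Set P} (hc : IsSatChain P c) :
    IsSatChain S (Subtype.val ⁻¹' c) := by
  refine ⟨fun x hx y hy hne => hc.1 hx hy (fun h => hne (Subtype.ext h)), ?_⟩
  intro x hx y hy hxy hz
  refine hS.covBy_iff.1 (hc.2 x hx y hy hxy fun z hzc h => ?_)
  exact hz ⟨z, hS x x.2 z (Or.inl h.1.le)⟩ hzc h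

theorem IsCompClosed.isSatChain_image {P : Type*} [PartialOrder P] {S : Set P}
    (hS : IsCompClosed S) {d : Set S} (hd : IsSatChain S d) :
    IsSatChain P (Subtype.val '' d) := by
  constructor
  · rintro _ ⟨x, hx, rfl⟩ _ ⟨y, hy, rfl⟩ hne
    exact hd.1 hx hy (fun h => hne (congrArg _ h))
  · rintro _ ⟨x, hx, rfl⟩ _ ⟨y, hy, rfl⟩ hxy hz
    exact hS.covBy_iff.2 (hd.2 x hx y hy hxy fun z hzd h => hz z ⟨z, hzd, rfl⟩ h)

theorem IsChainCover.preimage {P : Type*} [PartialOrder P] {C : Set (Set P)}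
    (hC : IsChainCover P C) {S : Set P} (hS : IsCompClosed S) :
    IsChainCover S ((Subtype.val ⁻¹' ·) '' C) := by
  refine ⟨?_, ?_, ?_⟩
  · rintro _ ⟨c, hc, rfl⟩
    exact hS.isSatChain_preimage (hC.1 c hc)
  · rintro _ ⟨c, hc, rfl⟩ _ ⟨c', hc', rfl⟩ hne
    exact (hC.2.1 hc hc' (fun h => hne (by rw [h]))).preimage _
  · intro x
    obtain ⟨c, hc, hx⟩ := hC.2.2 x
    exact ⟨_, ⟨c, hc, rfl⟩, hx⟩

open scoped Classical in
/-- Extension of a labeling of a subset by `0`. -/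
noncomputable def extendLabel {P : Type*} (S : Set P) (lam : S → ℝ) (x : P) : ℝ :=
  if h : x ∈ S then lam ⟨x, h⟩ else 0

theorem extendLabel_coe {P : Type*} {S : Set P} (lam : S → ℝ) (x : S) :
    extendLabel S lam x = lam x := by
  simp [extendLabel]

theorem extendLabel_of_notMem {P : Type*} {S : Set P} (lam : S → ℝ) {x : P} (hx : x ∉ S) :
    extendLabel S lam x = 0 := by
  simp [extendLabel, hx]

theorem IsCSort.extend {P : Type*} [PartialOrder P] {C : Set (Set P)} {S : Set P}
    (hS : IsCompClosed S) {lam mu : S → ℝ}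
    (h : IsCSort S ((Subtype.val ⁻¹' ·) '' C) lam mu) :
    IsCSort P C (extendLabel S lam) (extendLabel S mu) := by
  classical
  obtain ⟨σ, hσ, hmu, hsort⟩ := h
  refine ⟨Equiv.Perm.ofSubtype σ, ?_, ?_, ?_⟩
  · intro c hc x hx
    by_cases hxS : x ∈ S
    · rw [Equiv.Perm.ofSubtype_apply_of_mem σ hxS]
      exact hσ _ ⟨c, hc, rfl⟩ ⟨x, hxS⟩ hx
    · rwa [Equiv.Perm.ofSubtype_apply_of_not_mem σ hxS]
  · intro x
    by_cases hxS : x ∈ S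
    · rw [Equiv.Perm.ofSubtype_apply_of_mem σ hxS, extendLabel_coe, ← hmu,
        ← extendLabel_coe mu ⟨x, hxS⟩]
    · rw [Equiv.Perm.ofSubtype_apply_of_not_mem σ hxS, extendLabel_of_notMem _ hxS,
        extendLabel_of_notMem _ hxS]
  · intro c hc x hx y hy hxy
    by_cases hxS : x ∈ S
    · have hyS : y ∈ S := hS x hxS y (Or.inl hxy)
      simpa [extendLabel, hxS, hyS] using hsort _ ⟨c, hc, rfl⟩ ⟨x, hxS⟩ hx ⟨y, hyS⟩ hy hxy
    · have hyS : y ∉ S := fun hyS => hxS (hS y hyS x (Or.inr hxy))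
      rw [extendLabel_of_notMem _ hxS, extendLabel_of_notMem _ hyS]

theorem sortedAlong_of_extend {P : Type*} [PartialOrder P] {C : Set (Set P)} {S : Set P}
    {nu : S → ℝ} (h : SortedAlong P C (extendLabel S nu)) :
    SortedAlong S ((Subtype.val ⁻¹' ·) '' C) nu := by
  rintro _ ⟨c, hc, rfl⟩ x hx y hy hxy
  simpa only [extendLabel_coe] using h c hc x hx y hy hxy

theorem IsCSort.restrict {P : Type*} [PartialOrder P] {C : Set (Set P)}
    (hC : IsChainCover P C) {S : Set P} (hS : IsCompClosed S) {D : Set (Set S)}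
    (hD : ∀ d ∈ D, Subtype.val '' d ∈ C) {lam mu : P → ℝ} (h : IsCSort P C lam mu) :
    IsCSort S D (fun x => lam x) (fun x => mu x) := by
  obtain ⟨σ, hσ, hmu, hsort⟩ := h
  have hmem : ∀ x, σ x ∈ S ↔ x ∈ S := by
    intro x
    obtain ⟨c, hc, hx⟩ := hC.2.2 x
    have hσx := hσ c hc x hx
    exact ⟨hS.mem_of_isChain (hC.1 c hc).1 hσx hx, hS.mem_of_isChain (hC.1 c hc).1 hx hσx⟩
  refine ⟨σ.subtypePerm hmem, ?_, fun x => hmu x, ?_⟩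
  · intro d hd x hx
    obtain ⟨y, hy, hyx⟩ := hσ _ (hD d hd) x ⟨x, hx, rfl⟩
    have hy' : y = σ.subtypePerm hmem x := Subtype.ext hyx
    exact hy' ▸ hy
  · intro d hd x hx y hy hxy
    exact hsort _ (hD d hd) x ⟨x, hx, rfl⟩ y ⟨y, hy, rfl⟩ hxy

theorem InN2.of_isCompClosed {P : Type*} [PartialOrder P] (h : InN2 P) {S : Set P}
    (hS : IsCompClosed S) : InN2 S := by
  obtain ⟨C₁, C₂, h₁, h₂, h₁₂, h₂₁, hcov⟩ := h
  refine ⟨_, _, h₁.preimage hS, h₂.preimage hS, ?_, ?_, ?_⟩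
  · exact fun lam mu nu hl hm => sortedAlong_of_extend (h₁₂ _ _ _ (hl.extend hS) (hm.extend hS))
  · exact fun lam mu nu hl hm => sortedAlong_of_extend (h₂₁ _ _ _ (hl.extend hS) (hm.extend hS))
  · intro x y hxy
    obtain ⟨c, hc, hx, hy⟩ := hcov x y (hS.covBy_iff.2 hxy)
    exact ⟨_, hc.imp (fun h => ⟨c, h, rfl⟩) (fun h => ⟨c, h, rfl⟩), hx, hy⟩

/-- The union, over the connected components, of given families of subsets of them. -/
def componentUnion {P : Type*} [PartialOrder P]
    (D : ∀ S : Set.range (ConnComp P), Set (Set S.1)) : Set (Set P) :=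
  {c | ∃ S, ∃ d ∈ D S, Subtype.val '' d = c}

theorem isCompClosed_component {P : Type*} [PartialOrder P] (S : Set.range (ConnComp P)) :
    IsCompClosed S.1 := by
  obtain ⟨_, x, rfl⟩ := S
  exact isCompClosed_connComp x

theorem component_eq_of_mem {P : Type*} [PartialOrder P] {S T : Set.range (ConnComp P)} {x : P}
    (hS : x ∈ S.1) (hT : x ∈ T.1) : S = T := by
  obtain ⟨_, y, rfl⟩ := S
  obtain ⟨_, z, rfl⟩ := T
  exact Subtype.ext ((connComp_eq_of_mem hS).trans (connComp_eq_of_mem hT).symm)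

theorem isChainCover_componentUnion {P : Type*} [PartialOrder P]
    {D : ∀ S : Set.range (ConnComp P), Set (Set S.1)} (hD : ∀ S, IsChainCover S.1 (D S)) :
    IsChainCover P (componentUnion D) := by
  refine ⟨?_, ?_, ?_⟩
  · rintro _ ⟨S, d, hd, rfl⟩
    exact (isCompClosed_component S).isSatChain_image ((hD S).1 d hd)
  · rintro _ ⟨S, d, hd, rfl⟩ _ ⟨T, e, he, rfl⟩ hne
    refine Set.disjoint_left.2 ?_
    rintro _ ⟨x, hx, rfl⟩ ⟨y, hy, hyx⟩
    obtain rfl : S = T := component_eq_of_mem x.2 (hyx ▸ y.2)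
    obtain rfl : y = x := Subtype.ext hyx
    have hde : d ≠ e := fun h => hne (by rw [h])
    exact Set.disjoint_left.1 ((hD S).2.1 hd he hde) hx hy
  · intro x
    obtain ⟨d, hd, hx⟩ := (hD ⟨_, x, rfl⟩).2.2 ⟨x, mem_connComp_self x⟩
    exact ⟨_, ⟨_, d, hd, rfl⟩, _, hx, rfl⟩

theorem sortedAlong_componentUnion {P : Type*} [PartialOrder P]
    {D E : ∀ S : Set.range (ConnComp P), Set (Set S.1)} (hD : ∀ S, IsChainCover S.1 (D S))
    (hE : ∀ S, IsChainCover S.1 (E S))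
    (h : ∀ S, ∀ lam mu nu : S.1 → ℝ, IsCSort S.1 (D S) lam mu → IsCSort S.1 (E S) mu nu →
      SortedAlong S.1 (D S) nu)
    {lam mu nu : P → ℝ} (hl : IsCSort P (componentUnion D) lam mu)
    (hm : IsCSort P (componentUnion E) mu nu) : SortedAlong P (componentUnion D) nu := by
  rintro _ ⟨S, d, hd, rfl⟩ _ ⟨x, hx, rfl⟩ _ ⟨y, hy, rfl⟩ hxy
  have hS := isCompClosed_component S
  exact h S _ _ _
    (hl.restrict (isChainCover_componentUnion hD) hS fun d hd => ⟨S, d, hd, rfl⟩)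
    (hm.restrict (isChainCover_componentUnion hE) hS fun d hd => ⟨S, d, hd, rfl⟩) d hd x hx y hy hxy

/-- A finite poset belongs to `N₂` if and only if each of its connected components
belongs to `N₂`. -/
theorem inN2_iff_components {P : Type*} [PartialOrder P] [Finite P] :
    InN2 P ↔ ∀ x : P, InN2 ↥(ConnComp P x) := by
  refine ⟨fun h x => h.of_isCompClosed (isCompClosed_connComp x), fun h => ?_⟩
  have h' : ∀ S : Set.range (ConnComp P), InN2 S.1 := by
    rintro ⟨_, x, rfl⟩
    exact h x
  choose D E h₁ h₂ h₁₂ h₂₁ hcov using h'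
  refine ⟨componentUnion D, componentUnion E, isChainCover_componentUnion h₁,
    isChainCover_componentUnion h₂, fun _ _ _ => sortedAlong_componentUnion h₁ h₂ h₁₂,
    fun _ _ _ => sortedAlong_componentUnion h₂ h₁ h₂₁, fun x y hxy => ?_⟩
  have hx := mem_connComp_self x
  have hS := isCompClosed_connComp x
  have hy : y ∈ ConnComp P x := hS x hx y (Or.inl hxy.le)
  obtain ⟨c, hc, hxc, hyc⟩ := hcov ⟨_, x, rfl⟩ ⟨x, hx⟩ ⟨y, hy⟩ (hS.covBy_iff.1 hxy)
  exact ⟨Subtype.val '' c, hc.imp (fun h => ⟨_, c, h, rfl⟩) (fun h => ⟨_, c, h, rfl⟩),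
    ⟨_, hxc, rfl⟩, ⟨_, hyc, rfl⟩⟩
end

section
/- If a finite poset P has the non-messing-up property via a pair of chain covers {C₁, C₂}, then every element of P covers at most two elements of P and is covered by at most two elements of P. -/
theorem Set.ncard_le_two_of_subset_union_subsingleton {α : Type*} {s t u : Set α}
    (h : s ⊆ t ∪ u) (ht : t.Subsingleton) (hu : u.Subsingleton) : s.ncard ≤ 2 := by
  have h₁ := Set.ncard_le_ncard h (ht.finite.union hu.finite)
  have h₂ := Set.ncard_union_le t u
  have h₃ := (Set.ncard_le_one ht.finite).2 fun _ ha _ hb => ht ha hb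
  have h₄ := (Set.ncard_le_one hu.finite).2 fun _ ha _ hb => hu ha hb
  omega

theorem IsChainCover.eq_of_mem {P : Type*} [PartialOrder P] {C : Set (Set P)}
    (hC : IsChainCover P C) {c d : Set P} (hc : c ∈ C) (hd : d ∈ C) {x : P}
    (hxc : x ∈ c) (hxd : x ∈ d) : c = d :=
  hC.2.1.elim_set hc hd x hxc hxd

/-- In a chain cover, at most one element covered by `x` shares a chain with `x`. -/
theorem IsChainCover.subsingleton_lower {P : Type*} [PartialOrder P] {C : Set (Set P)}
    (hC : IsChainCover P C) (x : P) :
    {y : P | y ⋖ x ∧ ∃ c ∈ C, x ∈ c ∧ y ∈ c}.Subsingleton := by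
  rintro y ⟨hy, c, hc, hxc, hyc⟩ z ⟨hz, d, hd, hxd, hzd⟩
  obtain rfl := hC.eq_of_mem hc hd hxc hxd
  rcases (hC.1 c hc).1.total hyc hzd with hle | hle
  · exact hle.eq_of_not_lt fun hlt => hy.2 hlt hz.lt
  · exact (hle.eq_of_not_lt fun hlt => hz.2 hlt hy.lt).symm

/-- In a chain cover, at most one element covering `x` shares a chain with `x`. -/
theorem IsChainCover.subsingleton_upper {P : Type*} [PartialOrder P] {C : Set (Set P)}
    (hC : IsChainCover P C) (x : P) :
    {y : P | x ⋖ y ∧ ∃ c ∈ C, x ∈ c ∧ y ∈ c}.Subsingleton := by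
  rintro y ⟨hy, c, hc, hxc, hyc⟩ z ⟨hz, d, hd, hxd, hzd⟩
  obtain rfl := hC.eq_of_mem hc hd hxc hxd
  rcases (hC.1 c hc).1.total hyc hzd with hle | hle
  · exact hle.eq_of_not_lt fun hlt => hz.2 hy.lt hlt
  · exact (hle.eq_of_not_lt fun hlt => hy.2 hz.lt hlt).symm

/-- In a poset with the non-messing-up property, every element covers at most two
elements and is covered by at most two elements. -/
theorem nmu_cover_le_two {P : Type*} [PartialOrder P] [Finite P]
    (C₁ C₂ : Set (Set P)) (h : NMUvia P C₁ C₂) (x : P) :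
    {y : P | y ⋖ x}.ncard ≤ 2 ∧ {y : P | x ⋖ y}.ncard ≤ 2 := by
  obtain ⟨hC₁, hC₂, -, -, hedge⟩ := h
  constructor
  · refine Set.ncard_le_two_of_subset_union_subsingleton ?_
      (hC₁.subsingleton_lower x) (hC₂.subsingleton_lower x)
    intro y hy
    obtain ⟨c, hc | hc, hyc, hxc⟩ := hedge y x hy
    · exact Or.inl ⟨hy, c, hc, hxc, hyc⟩
    · exact Or.inr ⟨hy, c, hc, hxc, hyc⟩
  · refine Set.ncard_le_two_of_subset_union_subsingleton ?_
      (hC₁.subsingleton_upper x) (hC₂.subsingleton_upper x)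
    intro y hy
    obtain ⟨c, hc | hc, hxc, hyc⟩ := hedge x y hy
    · exact Or.inl ⟨hy, c, hc, hxc, hyc⟩
    · exact Or.inr ⟨hy, c, hc, hxc, hyc⟩
end

section
/- Let P be a finite poset with chain covers {C₁, C₂}, let x ⋖ y be an edge of a chain c ∈ C_i, and suppose that x and y each lie in a chain of C_{3−i} that is entirely contained in c. Then for every labeling λ : P → ℝ, if μ is the labeling obtained by C_i-sorting λ and ν is the labeling obtained from μ by C_{3−i}-sorting, then ν(x) = μ(x), ν(y) = μ(y), and ν(x) ≤ ν(y). -/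
/-- If `g = f ∘ σ` for an injection `σ` preserving a finite chain `d`, and both `f` and `g` are
weakly increasing along `d`, then `f ≤ g` on `d`. -/
theorem IsChain.le_of_monotoneOn_comp {P α : Type*} [PartialOrder P] [LinearOrder α] {d : Set P}
    (hd : IsChain (· ≤ ·) d) (hfin : d.Finite) {f g : P → α} (hf : MonotoneOn f d)
    (hg : MonotoneOn g d) {σ : P → P} (hσ : Set.InjOn σ d) (hσd : Set.MapsTo σ d d)
    (hgf : ∀ x ∈ d, g x = f (σ x)) {z : P} (hz : z ∈ d) : f z ≤ g z := by
  set A : Set P := {w | w ∈ d ∧ g w ≤ g z}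
  set B : Set P := {w | w ∈ d ∧ f w ≤ g z}
  have hA : A.Finite := hfin.subset fun _ h => h.1
  have hB : B.Finite := hfin.subset fun _ h => h.1
  have hcard : A.ncard ≤ B.ncard :=
    Set.ncard_le_ncard_of_injOn σ (fun w hw => ⟨hσd hw.1, hgf w hw.1 ▸ hw.2⟩)
      (hσ.mono fun _ h => h.1) hB
  have hAB : A ⊆ B := by
    by_contra hnot
    obtain ⟨a, haA, haB⟩ := Set.not_subset.mp hnot
    have hBA : B ⊆ A := by
      intro b hb
      rcases hd.total haA.1 hb.1 with hab | hba
      · exact absurd ⟨haA.1, (hf haA.1 hb.1 hab).trans hb.2⟩ haB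
      · exact ⟨hb.1, (hg hb.1 haA.1 hba).trans haA.2⟩
    exact hnot (Set.eq_of_subset_of_ncard_le hBA hcard hA).ge
  exact (hAB ⟨hz, le_rfl⟩).2

/-- Sorting does not change labels on a chain along which they are already weakly increasing. -/
theorem IsCSort.eq_of_monotoneOn {P : Type*} [PartialOrder P] [Finite P] {D : Set (Set P)}
    {mu nu : P → ℝ} (h : IsCSort P D mu nu) {d : Set P} (hd : d ∈ D) (hchain : IsChain (· ≤ ·) d)
    (hmu : MonotoneOn mu d) {z : P} (hz : z ∈ d) : nu z = mu z := by
  obtain ⟨σ, hσ, hnu, hsort⟩ := h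
  have hmono : MonotoneOn nu d := fun a ha b hb hab => hsort d hd a ha b hb hab
  have himage : σ '' d = d :=
    Set.eq_of_subset_of_ncard_le (Set.image_subset_iff.mpr (hσ d hd))
      (Set.ncard_image_of_injective d σ.injective).ge d.toFinite
  have hsymm : Set.MapsTo σ.symm d d := by
    intro w hw
    obtain ⟨v, hv, rfl⟩ := himage.ge hw
    simpa using hv
  exact le_antisymm
    (hchain.le_of_monotoneOn_comp d.toFinite hmono hmu σ.symm.injective.injOn hsymm
      (fun w _ => by simp [hnu]) hz)
    (hchain.le_of_monotoneOn_comp d.toFinite hmu hmono σ.injective.injOn (hσ d hd)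
      (fun w _ => hnu w) hz)

/-- Let `x ⋖ y` be an edge of a chain `c` of the chain cover `C`, and suppose `x` and `y`
lie in chains of the other cover `D` entirely contained in `c`. Then for any labeling,
after `C`-sorting and then `D`-sorting, the labels of `x` and `y` are unchanged by the
second sort and remain in order. -/
theorem edge_stays_sorted {P : Type*} [PartialOrder P] [Finite P]
    (C D : Set (Set P)) (hC : IsChainCover P C) (hD : IsChainCover P D)
    (c : Set P) (hc : c ∈ C) (x y : P) (hxy : x ⋖ y) (hx : x ∈ c) (hy : y ∈ c)
    (d₁ : Set P) (hd₁ : d₁ ∈ D) (hxd₁ : x ∈ d₁) (hd₁c : d₁ ⊆ c)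
    (d₂ : Set P) (hd₂ : d₂ ∈ D) (hyd₂ : y ∈ d₂) (hd₂c : d₂ ⊆ c) :
    ∀ lam mu nu : P → ℝ, IsCSort P C lam mu → IsCSort P D mu nu →
      nu x = mu x ∧ nu y = mu y ∧ nu x ≤ nu y := by
  intro lam mu nu hlam hmu
  obtain ⟨_, _, _, hsort⟩ := hlam
  have hmono : MonotoneOn mu c := fun a ha b hb hab => hsort c hc a ha b hb hab
  have hnux := hmu.eq_of_monotoneOn hd₁ (hD.1 d₁ hd₁).1 (hmono.mono hd₁c) hxd₁
  have hnuy := hmu.eq_of_monotoneOn hd₂ (hD.1 d₂ hd₂).1 (hmono.mono hd₂c) hyd₂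
  refine ⟨hnux, hnuy, ?_⟩
  rw [hnux, hnuy]
  exact hmono hx hy hxy.le
end

section
/- Every convex subposet of a poset in N₂ is also in N₂. More precisely, if a finite poset P has the non-messing-up property via the pair of chain covers {C₁, C₂} and Q is a convex subposet of P, then Q has the non-messing-up property via the pair of restricted chain covers {C₁|_Q, C₂|_Q}. -/
/-- The restriction of a chain cover of `P` to a subset `Q`: the nonempty intersections
of the chains with `Q`, viewed as subsets of the subposet `Q`. -/
def restrictCover (P : Type*) [PartialOrder P] (Q : Set P) (C : Set (Set P)) :
    Set (Set ↥Q) :=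
  {d | (∃ c ∈ C, d = {u : ↥Q | (u : P) ∈ c}) ∧ d.Nonempty}

theorem mem_restrictCover {P : Type*} [PartialOrder P] {Q : Set P} {C : Set (Set P)}
    {c : Set P} (hc : c ∈ C) (x : ↥Q) (hx : (x : P) ∈ c) :
    {u : ↥Q | (u : P) ∈ c} ∈ restrictCover P Q C :=
  ⟨⟨c, hc, rfl⟩, x, hx⟩

theorem Set.OrdConnected.coe_covBy_coe {P : Type*} [PartialOrder P] {Q : Set P}
    (hQ : Q.OrdConnected) {x y : ↥Q} : (x : P) ⋖ y ↔ x ⋖ y :=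
  ⟨fun h => ⟨h.1, fun z hxz hzy => h.2 (c := (z : P)) hxz hzy⟩,
    fun h => ⟨h.1, fun z hxz hzy =>
      h.2 (c := ⟨z, hQ.out x.2 y.2 ⟨hxz.le, hzy.le⟩⟩) hxz hzy⟩⟩

theorem IsChainCover.restrictCover {P : Type*} [PartialOrder P] {C : Set (Set P)}
    (hC : IsChainCover P C) {Q : Set P} (hQ : Q.OrdConnected) :
    IsChainCover ↥Q (restrictCover P Q C) := by
  obtain ⟨hchain, hdisj, hcover⟩ := hC
  refine ⟨?_, ?_, fun x => ?_⟩
  · rintro _ ⟨⟨c, hc, rfl⟩, -⟩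
    refine ⟨fun x hx y hy hxy => (hchain c hc).1 hx hy (Subtype.coe_injective.ne hxy), ?_⟩
    intro x hx y hy hxy hgap
    refine hQ.coe_covBy_coe.1 ((hchain c hc).2 x hx y hy hxy fun z hz hzxy => ?_)
    exact hgap ⟨z, hQ.out x.2 y.2 ⟨hzxy.1.le, hzxy.2.le⟩⟩ hz hzxy
  · rintro _ ⟨⟨c, hc, rfl⟩, -⟩ _ ⟨⟨c', hc', rfl⟩, -⟩ hne
    have hcc' : Disjoint c c' := hdisj hc hc' (by rintro rfl; exact hne rfl)
    exact Set.disjoint_left.2 fun x hx hx' => Set.disjoint_left.1 hcc' hx hx'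
  · obtain ⟨c, hc, hx⟩ := hcover x
    exact ⟨_, mem_restrictCover hc x hx, hx⟩

open Classical in
/-- Extend a labeling of `Q` to `P` by the constant `M` on the elements outside `Q` lying above
some element of `Q`, and by `-M` on all other elements outside `Q`. -/
noncomputable def extendLabeling {P : Type*} [PartialOrder P] (Q : Set P) (M : ℝ)
    (f : ↥Q → ℝ) (p : P) : ℝ :=
  if hp : p ∈ Q then f ⟨p, hp⟩ else if ∃ q ∈ Q, q ≤ p then M else -M

section extendLabeling

variable {P : Type*} [PartialOrder P] {Q : Set P} {M : ℝ} {f : ↥Q → ℝ}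

theorem extendLabeling_of_mem {p : P} (hp : p ∈ Q) :
    extendLabeling Q M f p = f ⟨p, hp⟩ := dif_pos hp

theorem extendLabeling_of_notMem {p : P} (hp : p ∉ Q) (g : ↥Q → ℝ) :
    extendLabeling Q M f p = extendLabeling Q M g p := by
  simp [extendLabeling, hp]

theorem extendLabeling_of_above {p q : P} (hp : p ∉ Q) (hq : q ∈ Q) (hqp : q ≤ p) :
    extendLabeling Q M f p = M := by
  rw [extendLabeling, dif_neg hp, if_pos ⟨q, hq, hqp⟩]

theorem extendLabeling_of_not_above {p : P} (hp : p ∉ Q) (h : ¬∃ q ∈ Q, q ≤ p) :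
    extendLabeling Q M f p = -M := by
  rw [extendLabeling, dif_neg hp, if_neg h]

theorem abs_extendLabeling_le (hM : 0 ≤ M) (hf : ∀ x, |f x| ≤ M) (p : P) :
    |extendLabeling Q M f p| ≤ M := by
  unfold extendLabeling
  split_ifs
  · exact hf _
  · exact (abs_of_nonneg hM).le
  · exact (abs_neg M).trans_le (abs_of_nonneg hM).le

theorem extendLabeling_le_extendLabeling (hQ : Q.OrdConnected) (hM : 0 ≤ M)
    (hf : ∀ x, |f x| ≤ M) {x y : P} (hxy : x ≤ y)
    (hmono : ∀ (hx : x ∈ Q) (hy : y ∈ Q), f ⟨x, hx⟩ ≤ f ⟨y, hy⟩) :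
    extendLabeling Q M f x ≤ extendLabeling Q M f y := by
  have hbound := abs_extendLabeling_le hM hf
  by_cases hx : x ∈ Q
  · by_cases hy : y ∈ Q
    · simpa only [extendLabeling_of_mem hx, extendLabeling_of_mem hy] using hmono hx hy
    · rw [extendLabeling_of_above hy hx hxy]
      exact (abs_le.1 (hbound x)).2
  · by_cases hax : ∃ q ∈ Q, q ≤ x
    · obtain ⟨q, hq, hqx⟩ := hax
      have hy : y ∉ Q := fun hy => hx (hQ.out hq hy ⟨hqx, hxy⟩)
      rw [extendLabeling_of_above hx hq hqx, extendLabeling_of_above hy hq (hqx.trans hxy)]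
    · rw [extendLabeling_of_not_above hx hax]
      exact (abs_le.1 (hbound y)).1

end extendLabeling

open Classical in
theorem IsCSort.extendLabeling {P : Type*} [PartialOrder P] {C : Set (Set P)} {Q : Set P}
    (hQ : Q.OrdConnected) {M : ℝ} (hM : 0 ≤ M) {lam mu : ↥Q → ℝ} (hmu : ∀ x, |mu x| ≤ M)
    (h : IsCSort ↥Q (restrictCover P Q C) lam mu) :
    IsCSort P C (extendLabeling Q M lam) (extendLabeling Q M mu) := by
  obtain ⟨σ, hσ, hmap, hsorted⟩ := h
  refine ⟨Equiv.Perm.ofSubtype σ, fun c hc x hx => ?_, fun x => ?_, ?_⟩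
  · by_cases hxQ : x ∈ Q
    · rw [Equiv.Perm.ofSubtype_apply_of_mem σ hxQ]
      exact hσ _ (mem_restrictCover hc ⟨x, hxQ⟩ hx) ⟨x, hxQ⟩ hx
    · rwa [Equiv.Perm.ofSubtype_apply_of_not_mem σ hxQ]
  · by_cases hxQ : x ∈ Q
    · rw [Equiv.Perm.ofSubtype_apply_of_mem σ hxQ, extendLabeling_of_mem hxQ,
        extendLabeling_of_mem (σ ⟨x, hxQ⟩).2, hmap]
    · rw [Equiv.Perm.ofSubtype_apply_of_not_mem σ hxQ, extendLabeling_of_notMem hxQ lam]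
  · intro c hc x hx y hy hxy
    exact extendLabeling_le_extendLabeling hQ hM hmu hxy fun hxQ hyQ =>
      hsorted _ (mem_restrictCover hc ⟨x, hxQ⟩ hx) ⟨x, hxQ⟩ hx ⟨y, hyQ⟩ hy hxy

theorem IsCSort.abs_le {P : Type*} [PartialOrder P] {C : Set (Set P)} {lam mu : P → ℝ}
    (h : IsCSort P C lam mu) {M : ℝ} (hlam : ∀ x, |lam x| ≤ M) (x : P) : |mu x| ≤ M := by
  obtain ⟨σ, -, hmap, -⟩ := h
  rw [hmap]
  exact hlam _

theorem sortedAlong_restrictCover {P : Type*} [PartialOrder P] [Finite P] {C₁ C₂ : Set (Set P)}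
    (h : ∀ lam mu nu : P → ℝ, IsCSort P C₁ lam mu → IsCSort P C₂ mu nu → SortedAlong P C₁ nu)
    {Q : Set P} (hQ : Q.OrdConnected) (lam mu nu : ↥Q → ℝ)
    (hmu : IsCSort ↥Q (restrictCover P Q C₁) lam mu)
    (hnu : IsCSort ↥Q (restrictCover P Q C₂) mu nu) :
    SortedAlong ↥Q (restrictCover P Q C₁) nu := by
  rintro _ ⟨⟨c, hc, rfl⟩, -⟩ x hx y hy hxy
  obtain ⟨M, hlam⟩ : ∃ M, ∀ x, |lam x| ≤ M := by
    obtain ⟨M, hM⟩ := (Set.finite_range fun x => |lam x|).bddAbove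
    exact ⟨M, fun x => hM ⟨x, rfl⟩⟩
  have hM : 0 ≤ M := (abs_nonneg _).trans (hlam x)
  have hmuM := hmu.abs_le hlam
  have key := h _ _ _ (hmu.extendLabeling hQ hM hmuM)
    (hnu.extendLabeling hQ hM (hnu.abs_le hmuM)) c hc x hx y hy hxy
  rwa [extendLabeling_of_mem x.2, extendLabeling_of_mem y.2] at key

/-- Every convex subposet of a poset in `N₂` is in `N₂`; more precisely, if `P` has the
non-messing-up property via `{C₁, C₂}` and `Q` is a convex subposet, then `Q` has the
non-messing-up property via the restricted chain covers. -/
theorem convex_subposet_nmu {P : Type*} [PartialOrder P] [Finite P]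
    (C₁ C₂ : Set (Set P)) (h : NMUvia P C₁ C₂) (Q : Set P) (hQ : Q.OrdConnected) :
    NMUvia ↥Q (restrictCover P Q C₁) (restrictCover P Q C₂) ∧ InN2 ↥Q := by
  suffices hNMU : NMUvia ↥Q (restrictCover P Q C₁) (restrictCover P Q C₂) from
    ⟨hNMU, _, _, hNMU⟩
  obtain ⟨hC₁, hC₂, h₁₂, h₂₁, hedge⟩ := h
  refine ⟨hC₁.restrictCover hQ, hC₂.restrictCover hQ, sortedAlong_restrictCover h₁₂ hQ,
    sortedAlong_restrictCover h₂₁ hQ, fun x y hxy => ?_⟩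
  obtain ⟨c, hc, hx, hy⟩ := hedge x y (hQ.coe_covBy_coe.2 hxy)
  exact ⟨_, hc.imp (mem_restrictCover · x hx) (mem_restrictCover · x hx), hx, hy⟩
end

section
/- Let P be a finite poset that has the non-messing-up property via the pair of chain covers {C₁, C₂}, and let c be a convex subposet of P that is a chain. Then some chain of C₁ or some chain of C₂ contains all of c. -/
/-- Two chains of a chain cover with a common element are equal. -/
theorem IsChainCover.eq_of_mem_s7 {P : Type*} [PartialOrder P] {C : Set (Set P)}
    (hC : IsChainCover P C) {A B : Set P} (hA : A ∈ C) (hB : B ∈ C) {x : P}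
    (hxA : x ∈ A) (hxB : x ∈ B) : A = B :=
  hC.2.1.elim_set hA hB x hxA hxB

/-- If sorting along `C₁` and then along `C₂` keeps the labels sorted along `C₁`, then no
interval `[a, b]` has `[a, b)` in a chain of `C₁` missing `b` and `(a, b]` in a chain of `C₂`
missing `a`, when `(a, b]` has a least element `y ≠ b`. -/
theorem not_Ico_subset_and_Ioc_subset {P : Type*} [PartialOrder P] {C₁ C₂ : Set (Set P)}
    (h₁ : IsChainCover P C₁) (h₂ : IsChainCover P C₂)
    (hsort : ∀ lam mu nu : P → ℝ, IsCSort P C₁ lam mu → IsCSort P C₂ mu nu →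
      SortedAlong P C₁ nu)
    {a b y : P} {A B : Set P} (hA : A ∈ C₁) (hB : B ∈ C₂)
    (hIco : Set.Ico a b ⊆ A) (hIoc : Set.Ioc a b ⊆ B) (hbA : b ∉ A) (haB : a ∉ B)
    (hay : a < y) (hyb : y < b) (hy : ∀ p ∈ Set.Ioc a b, y ≤ p) : False := by
  classical
  let lam : P → ℝ := fun p => if a ≤ p ∧ p ≠ b then 1 else 0
  let nu : P → ℝ := fun p => if a ≤ p ∧ p ≠ y then 1 else 0
  have hyB : y ∈ B := hIoc ⟨hay, hyb.le⟩
  have hbB : b ∈ B := hIoc ⟨hay.trans hyb, le_rfl⟩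
  have hlam : IsCSort P C₁ lam lam := by
    refine ⟨1, fun _ _ _ hx => hx, fun _ => rfl, fun E hE p hp q hq hpq => ?_⟩
    have key : a ≤ p ∧ p ≠ b → a ≤ q ∧ q ≠ b := by
      rintro ⟨hap, hpb⟩
      refine ⟨hap.trans hpq, ?_⟩
      rintro rfl
      have hpA : p ∈ A := hIco ⟨hap, lt_of_le_of_ne hpq hpb⟩
      exact hbA (h₁.eq_of_mem_s7 hE hA hp hpA ▸ hq)
    simp only [lam]
    split_ifs <;> first | (exfalso; tauto) | norm_num
  have hnu : IsCSort P C₂ lam nu := by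
    refine ⟨Equiv.swap y b, fun E hE p hp => ?_, fun p => ?_, fun E hE p hp q hq hpq => ?_⟩
    · rcases eq_or_ne p y with rfl | hpy
      · rw [Equiv.swap_apply_left, h₂.eq_of_mem_s7 hE hB hp hyB]
        exact hbB
      rcases eq_or_ne p b with rfl | hpb
      · rw [Equiv.swap_apply_right, h₂.eq_of_mem_s7 hE hB hp hbB]
        exact hyB
      · rwa [Equiv.swap_apply_of_ne_of_ne hpy hpb]
    · rcases eq_or_ne p y with rfl | hpy
      · simp [lam, nu]
      rcases eq_or_ne p b with rfl | hpb
      · simp [lam, nu, hay.le, (hay.trans hyb).le, hyb.ne, hyb.ne']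
      · simp [lam, nu, Equiv.swap_apply_of_ne_of_ne hpy hpb, hpy, hpb]
    · have key : a ≤ p ∧ p ≠ y → a ≤ q ∧ q ≠ y := by
        rintro ⟨hap, hpy⟩
        refine ⟨hap.trans hpq, ?_⟩
        rintro rfl
        have hpB : p ∈ B := h₂.eq_of_mem_s7 hE hB hq hyB ▸ hp
        have hne : a ≠ p := fun e => haB (e ▸ hpB)
        exact hpy (hpq.antisymm (hy p ⟨lt_of_le_of_ne hap hne, hpq.trans hyb.le⟩))
      simp only [nu]
      split_ifs <;> first | (exfalso; tauto) | norm_num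
  have hle := hsort lam lam nu hlam hnu A hA a (hIco ⟨le_rfl, hay.trans hyb⟩) y
    (hIco ⟨hay.le, hyb⟩) hay.le
  simp only [nu, le_refl, hay.ne, ne_eq, not_false_eq_true, and_self, not_true_eq_false,
    and_false, if_true, if_false] at hle
  norm_num at hle

/-- If a convex subposet of a non-messing-up poset is a chain, then some chain of one
of the two chain covers contains this entire subposet. -/
theorem convex_chain_in_cover {P : Type*} [PartialOrder P] [Finite P]
    (C₁ C₂ : Set (Set P)) (h : NMUvia P C₁ C₂)
    (c : Set P) (hne : c.Nonempty) (hchain : IsChain (· ≤ ·) c) (hconv : c.OrdConnected) :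
    ∃ d, (d ∈ C₁ ∨ d ∈ C₂) ∧ c ⊆ d := by
  induction hn : c.ncard using Nat.strong_induction_on generalizing c with
  | _ n ih =>
  subst hn
  obtain ⟨h₁, h₂, hs₁, hs₂, hedge⟩ := h
  have least : ∀ s ⊆ c, s.Nonempty → ∃ m ∈ s, ∀ x ∈ s, m ≤ x := by
    intro s hsc hs
    obtain ⟨m, hm⟩ := s.toFinite.exists_minimal hs
    exact ⟨m, hm.prop, fun x hx =>
      (hchain.total (hsc hm.prop) (hsc hx)).elim id (hm.le_of_le hx)⟩
  obtain ⟨a, hac, ha⟩ := least c subset_rfl hne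
  obtain ⟨b, hb⟩ := c.toFinite.exists_maximal hne
  have hbc : b ∈ c := hb.prop
  replace hb : ∀ x ∈ c, x ≤ b := fun x hx =>
    (hchain.total hx hbc).elim id (hb.le_of_ge hx)
  have hc : ∀ x, x ∈ c ↔ a ≤ x ∧ x ≤ b := fun x =>
    ⟨fun hx => ⟨ha x hx, hb x hx⟩, fun hx => hconv.out hac hbc hx⟩
  rcases (ha b hbc).eq_or_lt with rfl | hab
  · obtain ⟨d, hd, had⟩ := h₁.2.2 a
    exact ⟨d, Or.inl hd, fun x hx => (hb x hx).antisymm (ha x hx) ▸ had⟩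
  by_contra hcon
  have hIco : Set.Ico a b ⊆ c := fun x hx => (hc x).2 ⟨hx.1, hx.2.le⟩
  have hIoc : Set.Ioc a b ⊆ c := fun x hx => (hc x).2 ⟨hx.1.le, hx.2⟩
  obtain ⟨y, ⟨hay, hyb'⟩, hy⟩ := least (Set.Ioc a b) hIoc ⟨b, hab, le_rfl⟩
  rcases hyb'.eq_or_lt with rfl | hyb
  · obtain ⟨d, hd, had, hyd⟩ :=
      hedge a y ⟨hab, fun z haz hzy => (hy z ⟨haz, hzy.le⟩).not_gt hzy⟩
    refine hcon ⟨d, hd, fun x hx => ?_⟩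
    rcases (ha x hx).eq_or_lt with rfl | hax
    · exact had
    · exact (hb x hx).antisymm (hy x ⟨hax, hb x hx⟩) ▸ hyd
  obtain ⟨A, hA, hIcoA⟩ := ih _
    (Set.ncard_lt_ncard ⟨hIco, fun hsub => (hsub hbc).2.false⟩) (Set.Ico a b)
    ⟨a, le_rfl, hab⟩ (hchain.mono hIco) Set.ordConnected_Ico rfl
  obtain ⟨B, hB, hIocB⟩ := ih _
    (Set.ncard_lt_ncard ⟨hIoc, fun hsub => (hsub hac).1.false⟩) (Set.Ioc a b)
    ⟨b, hab, le_rfl⟩ (hchain.mono hIoc) Set.ordConnected_Ioc rfl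
  have hbA : b ∉ A := fun hbA => hcon ⟨A, hA, fun x hx =>
    (hb x hx).eq_or_lt.elim (fun e => e ▸ hbA) fun hxb => hIcoA ⟨ha x hx, hxb⟩⟩
  have haB : a ∉ B := fun haB => hcon ⟨B, hB, fun x hx =>
    (ha x hx).eq_or_lt.elim (fun e => e ▸ haB) fun hax => hIocB ⟨hax, hb x hx⟩⟩
  have hAB : A ≠ B := fun e => hbA (e ▸ hIocB ⟨hab, le_rfl⟩)
  have hyA : y ∈ A := hIcoA ⟨hay.le, hyb⟩
  have hyB : y ∈ B := hIocB ⟨hay, hyb.le⟩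
  rcases hA with hA | hA <;> rcases hB with hB | hB
  · exact hAB (h₁.eq_of_mem_s7 hA hB hyA hyB)
  · exact not_Ico_subset_and_Ioc_subset h₁ h₂ hs₁ hA hB hIcoA hIocB hbA haB hay hyb hy
  · exact not_Ico_subset_and_Ioc_subset h₂ h₁ hs₂ hA hB hIcoA hIocB hbA haB hay hyb hy
  · exact hAB (h₂.eq_of_mem_s7 hA hB hyA hyB)
end

section
/- Let M, N, k, l be nonnegative integers with k + 2 ≤ min{M, N} and l + 2 ≤ min{M, N}. Let P be the finite poset consisting of two saturated chains a = {x = a₀ ⋖ a₁ ⋖ ⋯ ⋖ a_M = y} and b = {x = b₀ ⋖ b₁ ⋖ ⋯ ⋖ b_N = y} meeting exactly in x and y, together with a bottom chain C of k elements whose maximum is covered by x and a top chain D of l elements whose minimum covers y, with no other order relations. Then P has the non-messing-up property via the pair of chain covers C₁ = { (C ∪ a)∖{y}, (b ∪ D)∖{x} } and C₂ = { (C ∪ b)∖{y}, (a ∪ D)∖{x} }. In particular, the bound max{|C|,|D|} < min{|a|−2, |b|−2} for Type I diamonds is sharp. -/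
/-- A partition of a poset into four chains `L`, `A`, `B`, `U`, where `L` lies below `A` and
`B`, which lie below `U`, while `A` and `B` are incomparable, and neither `L` nor `U` has more
elements than `A` or `B`. -/
structure IsDiamondPartition {P : Type*} [PartialOrder P] (L A B U : Set P) : Prop where
  chain_L : IsChain (· ≤ ·) L
  chain_A : IsChain (· ≤ ·) A
  chain_B : IsChain (· ≤ ·) B
  chain_U : IsChain (· ≤ ·) U
  mem : ∀ p, p ∈ L ∨ p ∈ A ∨ p ∈ B ∨ p ∈ U
  lt_LA : ∀ p ∈ L, ∀ q ∈ A, p < q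
  lt_LB : ∀ p ∈ L, ∀ q ∈ B, p < q
  lt_AU : ∀ p ∈ A, ∀ q ∈ U, p < q
  lt_BU : ∀ p ∈ B, ∀ q ∈ U, p < q
  not_le_AB : ∀ p ∈ A, ∀ q ∈ B, ¬ p ≤ q
  not_le_BA : ∀ p ∈ B, ∀ q ∈ A, ¬ p ≤ q
  nonempty_A : A.Nonempty
  nonempty_B : B.Nonempty
  card_LA : L.ncard ≤ A.ncard
  card_LB : L.ncard ≤ B.ncard
  card_UA : U.ncard ≤ A.ncard
  card_UB : U.ncard ≤ B.ncard

theorem IsChain.union_of_lt {P : Type*} [PartialOrder P] {S T : Set P}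
    (hS : IsChain (· ≤ ·) S) (hT : IsChain (· ≤ ·) T) (h : ∀ p ∈ S, ∀ q ∈ T, p < q) :
    IsChain (· ≤ ·) (S ∪ T) := by
  rintro p (hp | hp) q (hq | hq) hne
  · exact hS hp hq hne
  · exact Or.inl (h p hp q hq).le
  · exact Or.inr (h q hq p hp).le
  · exact hT hp hq hne

theorem IsSatChain.of_ordConnected {P : Type*} [PartialOrder P] {c : Set P}
    (hc : IsChain (· ≤ ·) c) (h : c.OrdConnected) : IsSatChain P c :=
  ⟨hc, fun _ hx _ hy hxy hz =>
    ⟨hxy, fun z h1 h2 => hz z (h.out hx hy ⟨h1.le, h2.le⟩) ⟨h1, h2⟩⟩⟩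

/-- Sorting along a chain cover preserves, on each chain, the number of labels at most `r`. -/
theorem IsCSort.ncard_le_eq {P : Type*} [PartialOrder P] [Finite P] {C : Set (Set P)}
    {lam mu : P → ℝ} (h : IsCSort P C lam mu) {c : Set P} (hc : c ∈ C) (r : ℝ) :
    (c ∩ {x | mu x ≤ r}).ncard = (c ∩ {x | lam x ≤ r}).ncard := by
  obtain ⟨σ, hσ, hmu, -⟩ := h
  have himg : σ '' c = c :=
    Set.eq_of_subset_of_ncard_le (Set.image_subset_iff.2 (hσ c hc))
      (Set.ncard_image_of_injective c σ.injective).ge (Set.toFinite c)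
  rw [← Set.ncard_image_of_injective (c ∩ {x | mu x ≤ r}) σ.injective]
  congr 1
  ext y
  constructor
  · rintro ⟨x, ⟨hx, hxr⟩, rfl⟩
    exact ⟨hσ c hc x hx, by simpa [← hmu] using hxr⟩
  · rintro ⟨hy, hyr⟩
    obtain ⟨x, hx, rfl⟩ := himg.symm ▸ hy
    exact ⟨x, ⟨hx, by simpa [hmu] using hyr⟩, rfl⟩

/-- If a labeling is increasing along `S ∪ T` with `S` below `T`, and some label on `T` is at
most `r`, then all labels on `S` are. -/
theorem ncard_inter_le_eq_of_sorted {P : Type*} [PartialOrder P] [Finite P] {S T : Set P}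
    {f : P → ℝ} (hf : ∀ p ∈ S ∪ T, ∀ q ∈ S ∪ T, p ≤ q → f p ≤ f q)
    (hlt : ∀ p ∈ S, ∀ q ∈ T, p < q) {r : ℝ} (h : 0 < (T ∩ {x | f x ≤ r}).ncard) :
    (S ∩ {x | f x ≤ r}).ncard = S.ncard := by
  obtain ⟨q, hq, hqr⟩ := (Set.ncard_pos (Set.toFinite _)).1 h
  congr 1
  exact Set.inter_eq_left.2 fun p hp =>
    (hf p (Or.inl hp) q (Or.inr hq) (hlt p hp q hq).le).trans hqr

theorem ncard_union_inter_of_lt {P : Type*} [PartialOrder P] [Finite P] {S T : Set P}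
    (hlt : ∀ p ∈ S, ∀ q ∈ T, p < q) (Z : Set P) :
    ((S ∪ T) ∩ Z).ncard = (S ∩ Z).ncard + (T ∩ Z).ncard := by
  rw [Set.union_inter_distrib_right]
  refine Set.ncard_union_eq ?_ (Set.toFinite _) (Set.toFinite _)
  exact Set.disjoint_left.2 fun p hp hq => (hlt p hp.1 p hq.1).false

theorem ncard_inter_pos {P : Type*} [Finite P] {S Z : Set P} {p : P}
    (hp : p ∈ S) (hZ : p ∈ Z) : 0 < (S ∩ Z).ncard :=
  (Set.ncard_pos (Set.toFinite _)).2 ⟨p, hp, hZ⟩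

theorem ncard_inter_lt {P : Type*} [Finite P] {S Z : Set P} {p : P}
    (hp : p ∈ S) (hZ : p ∉ Z) : (S ∩ Z).ncard < S.ncard :=
  Set.ncard_lt_ncard ⟨Set.inter_subset_left, fun h => hZ (h hp).2⟩ (Set.toFinite _)

namespace IsDiamondPartition

variable {P : Type*} [PartialOrder P] {L A B U : Set P}

theorem symm (h : IsDiamondPartition L A B U) : IsDiamondPartition L B A U where
  chain_L := h.chain_L
  chain_A := h.chain_B
  chain_B := h.chain_A
  chain_U := h.chain_U
  mem p := by have := h.mem p; tauto
  lt_LA := h.lt_LB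
  lt_LB := h.lt_LA
  lt_AU := h.lt_BU
  lt_BU := h.lt_AU
  not_le_AB := h.not_le_BA
  not_le_BA := h.not_le_AB
  nonempty_A := h.nonempty_B
  nonempty_B := h.nonempty_A
  card_LA := h.card_LB
  card_LB := h.card_LA
  card_UA := h.card_UB
  card_UB := h.card_UA

theorem lt_LU (h : IsDiamondPartition L A B U) : ∀ p ∈ L, ∀ q ∈ U, p < q := by
  obtain ⟨z, hz⟩ := h.nonempty_A
  exact fun p hp q hq => (h.lt_LA p hp z hz).trans (h.lt_AU z hz q hq)

theorem isLowerSet (h : IsDiamondPartition L A B U) : IsLowerSet (L ∪ A) := by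
  rintro q p hpq (hq | hq) <;> rcases h.mem p with hp | hp | hp | hp
  · exact Or.inl hp
  · exact Or.inr hp
  · exact absurd hpq (h.lt_LB q hq p hp).not_ge
  · exact absurd hpq (h.lt_LU q hq p hp).not_ge
  · exact Or.inl hp
  · exact Or.inr hp
  · exact absurd hpq (h.not_le_BA p hp q hq)
  · exact absurd hpq (h.lt_AU q hq p hp).not_ge

theorem isUpperSet (h : IsDiamondPartition L A B U) : IsUpperSet (B ∪ U) := by
  rintro q p hqp (hq | hq) <;> rcases h.mem p with hp | hp | hp | hp
  · exact absurd hqp (h.lt_LB p hp q hq).not_ge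
  · exact absurd hqp (h.not_le_BA q hq p hp)
  · exact Or.inl hp
  · exact Or.inr hp
  · exact absurd hqp (h.lt_LU p hp q hq).not_ge
  · exact absurd hqp (h.lt_AU p hp q hq).not_ge
  · exact Or.inl hp
  · exact Or.inr hp

theorem disjoint (h : IsDiamondPartition L A B U) : Disjoint (L ∪ A) (B ∪ U) := by
  refine Set.disjoint_left.2 ?_
  rintro p (hp | hp) (hq | hq)
  · exact (h.lt_LB p hp p hq).false
  · exact (h.lt_LU p hp p hq).false
  · exact h.not_le_AB p hp p hq le_rfl
  · exact (h.lt_AU p hp p hq).false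

theorem isChainCover (h : IsDiamondPartition L A B U) :
    IsChainCover P {L ∪ A, B ∪ U} := by
  refine ⟨?_, ?_, fun p => ?_⟩
  · rintro c (rfl | rfl)
    · exact .of_ordConnected (h.chain_L.union_of_lt h.chain_A h.lt_LA) h.isLowerSet.ordConnected
    · exact .of_ordConnected (h.chain_B.union_of_lt h.chain_U h.lt_BU) h.isUpperSet.ordConnected
  · rintro c (rfl | rfl) d (rfl | rfl) hne
    · exact absurd rfl hne
    · exact h.disjoint
    · exact h.disjoint.symm
    · exact absurd rfl hne
  · rcases h.mem p with hp | hp | hp | hp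
    · exact ⟨L ∪ A, by simp, Or.inl hp⟩
    · exact ⟨L ∪ A, by simp, Or.inr hp⟩
    · exact ⟨B ∪ U, by simp, Or.inl hp⟩
    · exact ⟨B ∪ U, by simp, Or.inr hp⟩

/-- The numbers of labels at most `r` in the four blocks determine whether the sorted order
survives, and these numbers are controlled by the block sizes. -/
theorem sortedAlong [Finite P] (h : IsDiamondPartition L A B U) {lam mu nu : P → ℝ}
    (hmu : IsCSort P {L ∪ A, B ∪ U} lam mu) (hnu : IsCSort P {L ∪ B, A ∪ U} mu nu) :
    SortedAlong P {L ∪ A, B ∪ U} nu := by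
  have memL {S T : Set P} : S ∈ ({S, T} : Set (Set P)) := Or.inl rfl
  have memR {S T : Set P} : T ∈ ({S, T} : Set (Set P)) := Or.inr rfl
  obtain ⟨-, -, -, smu⟩ := id hmu
  obtain ⟨-, -, -, snu⟩ := id hnu
  have key (r : ℝ) :
      (0 < (A ∩ {x | nu x ≤ r}).ncard → L.ncard ≤ (L ∩ {x | nu x ≤ r}).ncard) ∧
      (0 < (U ∩ {x | nu x ≤ r}).ncard → B.ncard ≤ (B ∩ {x | nu x ≤ r}).ncard) := by
    have e₁ := hnu.ncard_le_eq memL r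
    have e₂ := hnu.ncard_le_eq memR r
    rw [ncard_union_inter_of_lt h.lt_LB, ncard_union_inter_of_lt h.lt_LB] at e₁
    rw [ncard_union_inter_of_lt h.lt_AU, ncard_union_inter_of_lt h.lt_AU] at e₂
    have m₁ := ncard_inter_le_eq_of_sorted (r := r) (smu _ memL) h.lt_LA
    have m₂ := ncard_inter_le_eq_of_sorted (r := r) (smu _ memR) h.lt_BU
    have n₁ := ncard_inter_le_eq_of_sorted (r := r) (snu _ memL) h.lt_LB
    have n₂ := ncard_inter_le_eq_of_sorted (r := r) (snu _ memR) h.lt_AU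
    have lL := Set.ncard_le_ncard (Set.inter_subset_left (s := L) (t := {x | nu x ≤ r}))
    have lA := Set.ncard_le_ncard (Set.inter_subset_left (s := A) (t := {x | mu x ≤ r}))
    have lU := Set.ncard_le_ncard (Set.inter_subset_left (s := U) (t := {x | mu x ≤ r}))
    have := h.card_LB
    have := h.card_UA
    constructor <;> intro <;> omega
  rintro c (rfl | rfl) p hp q hq hpq
  · rcases hp with hp | hp <;> rcases hq with hq | hq
    · exact snu _ memL p (Or.inl hp) q (Or.inl hq) hpq
    · by_contra hlt
      have := (key (nu q)).1 (ncard_inter_pos hq (le_refl (nu q)))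
      exact absurd this (ncard_inter_lt hp hlt).not_ge
    · exact absurd hpq (h.lt_LA q hq p hp).not_ge
    · exact snu _ memR p (Or.inl hp) q (Or.inl hq) hpq
  · rcases hp with hp | hp <;> rcases hq with hq | hq
    · exact snu _ memL p (Or.inr hp) q (Or.inr hq) hpq
    · by_contra hlt
      have := (key (nu q)).2 (ncard_inter_pos hq (le_refl (nu q)))
      exact absurd this (ncard_inter_lt hp hlt).not_ge
    · exact absurd hpq (h.lt_BU q hq p hp).not_ge
    · exact snu _ memR p (Or.inr hp) q (Or.inr hq) hpq

theorem exists_chain_of_covBy (h : IsDiamondPartition L A B U) {p q : P} (hpq : p ⋖ q) :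
    ∃ c, (c ∈ ({L ∪ A, B ∪ U} : Set (Set P)) ∨ c ∈ ({L ∪ B, A ∪ U} : Set (Set P))) ∧
      p ∈ c ∧ q ∈ c := by
  have hLA : q ∈ L ∪ A → p ∈ L ∪ A := fun hq => h.isLowerSet hpq.le hq
  have hLB : q ∈ L ∪ B → p ∈ L ∪ B := fun hq => h.symm.isLowerSet hpq.le hq
  by_cases hA : q ∈ L ∪ A
  · exact ⟨L ∪ A, by simp, hLA hA, hA⟩
  by_cases hB : q ∈ L ∪ B
  · exact ⟨L ∪ B, by simp, hLB hB, hB⟩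
  have hq : q ∈ U := by
    have := h.mem q
    simp only [Set.mem_union] at hA hB
    tauto
  rcases h.mem p with hp | hp | hp | hp
  · obtain ⟨z, hz⟩ := h.nonempty_A
    exact absurd (h.lt_AU z hz q hq) (hpq.2 (h.lt_LA p hp z hz))
  · exact ⟨A ∪ U, by simp, Or.inl hp, Or.inr hq⟩
  · exact ⟨B ∪ U, by simp, Or.inl hp, Or.inr hq⟩
  · exact ⟨B ∪ U, by simp, Or.inr hp, Or.inr hq⟩

theorem nmuVia [Finite P] (h : IsDiamondPartition L A B U) :
    NMUvia P {L ∪ A, B ∪ U} {L ∪ B, A ∪ U} :=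
  ⟨h.isChainCover, h.symm.isChainCover, fun _ _ _ => h.sortedAlong,
    fun _ _ _ => h.symm.sortedAlong, fun _ _ => h.exists_chain_of_covBy⟩

end IsDiamondPartition

theorem isChain_range_of_monotone {ι P : Type*} [LinearOrder ι] [PartialOrder P] {f : ι → P}
    (hf : Monotone f) : IsChain (· ≤ ·) (Set.range f) := by
  rintro _ ⟨i, rfl⟩ _ ⟨j, rfl⟩ -
  exact (le_total i j).imp (fun h => hf h) (fun h => hf h)

theorem ncard_image_Ioo_zero_last {P : Type*} {n : ℕ} {f : Fin (n + 1) → P}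
    (hf : Function.Injective f) : (f '' Set.Ioo 0 (Fin.last n)).ncard = n - 1 := by
  rw [Set.ncard_image_of_injective _ hf, ← Finset.coe_Ioo, Set.ncard_coe_finset, Fin.card_Ioo]
  simp

theorem range_diff_last {P : Type*} {n : ℕ} (hn : 0 < n) {f : Fin (n + 1) → P}
    (hf : Function.Injective f) :
    Set.range f \ {f (Fin.last n)} = {f 0} ∪ f '' Set.Ioo 0 (Fin.last n) := by
  have h0 : (0 : Fin (n + 1)) < Fin.last n := by simpa [Fin.lt_def] using hn
  rw [← Set.image_univ, ← Set.image_singleton (a := 0), ← Set.image_singleton (a := Fin.last n),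
    ← Set.image_sdiff hf, ← Set.image_union]
  congr 1
  ext i
  simp only [Set.mem_sdiff, Set.mem_univ, true_and, Set.mem_singleton_iff, Set.mem_union,
    Set.mem_Ioo, Fin.pos_iff_ne_zero, Fin.lt_last_iff_ne_last]
  have := h0.ne
  by_cases hi : i = 0 <;> simp_all

theorem range_diff_zero {P : Type*} {n : ℕ} (hn : 0 < n) {f : Fin (n + 1) → P}
    (hf : Function.Injective f) :
    Set.range f \ {f 0} = f '' Set.Ioo 0 (Fin.last n) ∪ {f (Fin.last n)} := by
  have h0 : (0 : Fin (n + 1)) < Fin.last n := by simpa [Fin.lt_def] using hn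
  rw [← Set.image_univ, ← Set.image_singleton (a := 0), ← Set.image_singleton (a := Fin.last n),
    ← Set.image_sdiff hf, ← Set.image_union]
  congr 1
  ext i
  simp only [Set.mem_sdiff, Set.mem_univ, true_and, Set.mem_singleton_iff, Set.mem_union,
    Set.mem_Ioo, Fin.pos_iff_ne_zero, Fin.lt_last_iff_ne_last]
  have := h0.ne'
  by_cases hi : i = Fin.last n <;> simp_all

theorem nonempty_image_Ioo_zero_last {P : Type*} {n : ℕ} (hn : 1 < n) {f : Fin (n + 1) → P}
    (hf : Function.Injective f) : (f '' Set.Ioo 0 (Fin.last n)).Nonempty :=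
  Set.nonempty_of_ncard_ne_zero (by rw [ncard_image_Ioo_zero_last hf]; omega)

/-- Sharpness of the Type I bounds: the poset consisting of a diamond with chains
`a = {x = a₀ ⋖ ⋯ ⋖ a_M = y}` and `b = {x = b₀ ⋖ ⋯ ⋖ b_N = y}` meeting exactly in `x` and
`y`, a bottom chain `cc` of `k` elements below `x` and a top chain `dd` of `l` elements
above `y`, with no other relations, has the non-messing-up property via
`C₁ = {(C ∪ a) ∖ {y}, (b ∪ D) ∖ {x}}` and `C₂ = {(C ∪ b) ∖ {y}, (a ∪ D) ∖ {x}}`,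
provided `k + 2 ≤ min {M, N}` and `l + 2 ≤ min {M, N}`. -/
theorem typeI_bound_sharp (M N k l : ℕ)
    (hk : k + 2 ≤ min M N) (hl : l + 2 ≤ min M N)
    (P : Type*) [PartialOrder P] [Finite P]
    (a : Fin (M + 1) → P) (b : Fin (N + 1) → P) (cc : Fin k → P) (dd : Fin l → P)
    (ha : Function.Injective a) (hb : Function.Injective b)
    (hcc : Function.Injective cc) (hdd : Function.Injective dd)
    (hx : a 0 = b 0) (hy : a (Fin.last M) = b (Fin.last N))
    (hab : Set.range a ∩ Set.range b = {a 0, a (Fin.last M)})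
    (hcdisj : Disjoint (Set.range cc) (Set.range a ∪ Set.range b ∪ Set.range dd))
    (hddisj : Disjoint (Set.range dd) (Set.range a ∪ Set.range b))
    (hsurj : ∀ p : P, p ∈ Set.range a ∪ Set.range b ∪ Set.range cc ∪ Set.range dd)
    (hle : ∀ p q : P, p ≤ q ↔
      (∃ i j : Fin k, i ≤ j ∧ p = cc i ∧ q = cc j) ∨
      (∃ i j : Fin (M + 1), i ≤ j ∧ p = a i ∧ q = a j) ∨
      (∃ i j : Fin (N + 1), i ≤ j ∧ p = b i ∧ q = b j) ∨
      (∃ i j : Fin l, i ≤ j ∧ p = dd i ∧ q = dd j) ∨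
      ((∃ i, p = cc i) ∧ q ∈ Set.range a ∪ Set.range b ∪ Set.range dd) ∨
      (p ∈ Set.range a ∪ Set.range b ∧ ∃ j, q = dd j)) :
    NMUvia P
      {Set.range cc ∪ (Set.range a \ {a (Fin.last M)}),
        (Set.range b \ {b 0}) ∪ Set.range dd}
      {Set.range cc ∪ (Set.range b \ {b (Fin.last N)}),
        (Set.range a \ {a 0}) ∪ Set.range dd} := by
  obtain ⟨hkM, hkN⟩ := le_min_iff.1 hk
  obtain ⟨hlM, hlN⟩ := le_min_iff.1 hl
  have mono_a : Monotone a := fun i j hij => (hle _ _).2 (.inr (.inl ⟨i, j, hij, rfl, rfl⟩))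
  have mono_b : Monotone b :=
    fun i j hij => (hle _ _).2 (.inr (.inr (.inl ⟨i, j, hij, rfl, rfl⟩)))
  have mono_c : Monotone cc := fun i j hij => (hle _ _).2 (.inl ⟨i, j, hij, rfl, rfl⟩)
  have mono_d : Monotone dd :=
    fun i j hij => (hle _ _).2 (.inr (.inr (.inr (.inl ⟨i, j, hij, rfl, rfl⟩))))
  have strict_a := mono_a.strictMono_of_injective ha
  have strict_b := mono_b.strictMono_of_injective hb
  have c_lt {i q} (hq : q ∈ Set.range a ∪ Set.range b ∪ Set.range dd) : cc i < q :=
    lt_of_le_of_ne ((hle _ _).2 (.inr (.inr (.inr (.inr (.inl ⟨⟨i, rfl⟩, hq⟩))))))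
      fun h => Set.disjoint_left.1 hcdisj ⟨i, h⟩ hq
  have lt_d {p j} (hp : p ∈ Set.range a ∪ Set.range b) : p < dd j :=
    lt_of_le_of_ne ((hle _ _).2 (.inr (.inr (.inr (.inr (.inr ⟨hp, ⟨j, rfl⟩⟩))))))
      fun h => Set.disjoint_left.1 hddisj ⟨j, rfl⟩ (h ▸ hp)
  have c_notMem (i) : cc i ∉ Set.range a ∪ Set.range b := fun h => (c_lt (.inl h)).false
  have d_notMem (j) : dd j ∉ Set.range a ∪ Set.range b := fun h => (lt_d h).false
  have a_notMem_b {i} (hi : i ∈ Set.Ioo 0 (Fin.last M)) : a i ∉ Set.range b := fun h => by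
    rcases (hab ▸ ⟨⟨i, rfl⟩, h⟩ : a i ∈ ({a 0, a (Fin.last M)} : Set P)) with h | h
    · exact hi.1.ne' (ha h)
    · exact hi.2.ne (ha h)
  have b_notMem_a {i} (hi : i ∈ Set.Ioo 0 (Fin.last N)) : b i ∉ Set.range a := fun h => by
    rcases (hab ▸ ⟨h, ⟨i, rfl⟩⟩ : b i ∈ ({a 0, a (Fin.last M)} : Set P)) with h | h
    · exact hi.1.ne' (hb (h.trans hx))
    · exact hi.2.ne (hb (h.trans hy))
  have hmem_a {p} : p ∈ Set.range a →
      p = a 0 ∨ p ∈ a '' Set.Ioo 0 (Fin.last M) ∨ p = a (Fin.last M) := fun hp => by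
    by_cases h : p = a (Fin.last M)
    · exact .inr (.inr h)
    · have : p ∈ Set.range a \ {a (Fin.last M)} := ⟨hp, h⟩
      rw [range_diff_last (by omega) ha] at this
      exact this.imp_right .inl
  have hmem_b {p} : p ∈ Set.range b →
      p = a 0 ∨ p ∈ b '' Set.Ioo 0 (Fin.last N) ∨ p = a (Fin.last M) := fun hp => by
    rw [hx, hy]
    by_cases h : p = b (Fin.last N)
    · exact .inr (.inr h)
    · have : p ∈ Set.range b \ {b (Fin.last N)} := ⟨hp, h⟩
      rw [range_diff_last (by omega) hb] at this
      exact this.imp_right .inl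
  have card_L : (Set.range cc ∪ {a 0}).ncard ≤ k + 1 := by
    refine (Set.ncard_union_le _ _).trans ?_
    rw [Set.ncard_singleton, ← Set.image_univ, Set.ncard_image_of_injective _ hcc]
    simp
  have card_U : ({a (Fin.last M)} ∪ Set.range dd).ncard ≤ l + 1 := by
    refine (Set.ncard_union_le _ _).trans ?_
    rw [Set.ncard_singleton, ← Set.image_univ, Set.ncard_image_of_injective _ hdd]
    simp [add_comm]
  have card_A := ncard_image_Ioo_zero_last ha
  have card_B := ncard_image_Ioo_zero_last hb
  have hpart : IsDiamondPartition (Set.range cc ∪ {a 0}) (a '' Set.Ioo 0 (Fin.last M))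
      (b '' Set.Ioo 0 (Fin.last N)) ({a (Fin.last M)} ∪ Set.range dd) :=
    { chain_L := (isChain_range_of_monotone mono_c).union_of_lt IsChain.singleton (by
        rintro _ ⟨i, rfl⟩ _ rfl
        exact c_lt (.inl (.inl ⟨0, rfl⟩)))
      chain_A := (isChain_range_of_monotone mono_a).mono (Set.image_subset_range _ _)
      chain_B := (isChain_range_of_monotone mono_b).mono (Set.image_subset_range _ _)
      chain_U := IsChain.singleton.union_of_lt (isChain_range_of_monotone mono_d) (by
        rintro _ rfl _ ⟨j, rfl⟩
        exact lt_d (.inl ⟨_, rfl⟩))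
      mem := fun p => by
        rcases hsurj p with ((hp | hp) | hp) | hp
        · rcases hmem_a hp with h | h | h <;> simp [h]
        · rcases hmem_b hp with h | h | h <;> simp [h]
        · exact .inl (.inl hp)
        · exact .inr (.inr (.inr (.inr hp)))
      lt_LA := by
        rintro _ (⟨i, rfl⟩ | rfl) _ ⟨j, hj, rfl⟩
        · exact c_lt (.inl (.inl ⟨j, rfl⟩))
        · exact strict_a hj.1
      lt_LB := by
        rintro _ (⟨i, rfl⟩ | rfl) _ ⟨j, hj, rfl⟩
        · exact c_lt (.inl (.inr ⟨j, rfl⟩))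
        · exact hx ▸ strict_b hj.1
      lt_AU := by
        rintro _ ⟨i, hi, rfl⟩ _ (rfl | ⟨j, rfl⟩)
        · exact strict_a hi.2
        · exact lt_d (.inl ⟨i, rfl⟩)
      lt_BU := by
        rintro _ ⟨i, hi, rfl⟩ _ (rfl | ⟨j, rfl⟩)
        · exact hy ▸ strict_b hi.2
        · exact lt_d (.inr ⟨i, rfl⟩)
      not_le_AB := by
        rintro _ ⟨i, hi, rfl⟩ _ ⟨j, hj, rfl⟩ h
        rcases (hle _ _).1 h with ⟨i', -, -, h, -⟩ | ⟨-, j', -, -, h⟩ | ⟨i', -, -, h, -⟩ |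
          ⟨i', -, -, h, -⟩ | ⟨⟨i', h⟩, -⟩ | ⟨-, j', h⟩
        · exact c_notMem i' (h ▸ .inl ⟨i, rfl⟩)
        · exact b_notMem_a hj ⟨j', h.symm⟩
        · exact a_notMem_b hi ⟨i', h.symm⟩
        · exact d_notMem i' (h ▸ .inl ⟨i, rfl⟩)
        · exact c_notMem i' (h ▸ .inl ⟨i, rfl⟩)
        · exact d_notMem j' (h ▸ .inr ⟨j, rfl⟩)
      not_le_BA := by
        rintro _ ⟨i, hi, rfl⟩ _ ⟨j, hj, rfl⟩ h
        rcases (hle _ _).1 h with ⟨i', -, -, h, -⟩ | ⟨i', -, -, h, -⟩ | ⟨-, j', -, -, h⟩ |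
          ⟨i', -, -, h, -⟩ | ⟨⟨i', h⟩, -⟩ | ⟨-, j', h⟩
        · exact c_notMem i' (h ▸ .inr ⟨i, rfl⟩)
        · exact b_notMem_a hi ⟨i', h.symm⟩
        · exact a_notMem_b hj ⟨j', h.symm⟩
        · exact d_notMem i' (h ▸ .inr ⟨i, rfl⟩)
        · exact c_notMem i' (h ▸ .inr ⟨i, rfl⟩)
        · exact d_notMem j' (h ▸ .inl ⟨j, rfl⟩)
      nonempty_A := nonempty_image_Ioo_zero_last (by omega) ha
      nonempty_B := nonempty_image_Ioo_zero_last (by omega) hb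
      card_LA := by omega
      card_LB := by omega
      card_UA := by omega
      card_UB := by omega }
  rw [range_diff_last (by omega) ha, range_diff_zero (by omega) ha,
    range_diff_last (by omega) hb, range_diff_zero (by omega) hb, ← hx, ← hy]
  simpa only [Set.union_assoc] using hpart.nmuVia
end
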